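/- Let P_{m,k} be a generalized Petersen graph (m ≥ 3, k ≥ 1) of order 2m and T a tree of order n; let d_p = diam(P_{m,k}), d_t = diam(T), ε = ε(T). Suppose there exists an ordering z_0, z_1, …, z_{2mn−1} of the vertices of P_{m,k} □ T, with z_t = (x_{i_t}, y_{j_t}), such that: (a) d_{P_{m,k}}(x_{i_t}, x_{i_{t+1}}) = d_p for all 0 ≤ t ≤ 2mn − 2, and for all 0 ≤ a < b ≤ 2mn − 1 with b ≥ a + 2, d_{P_{m,k}}(x_{i_a}, x_{i_b}) ≥ d_p − (b − a − 1) if |W(T)| = 1 and d_{P_{m,k}}(x_{i_a}, x_{i_b}) ≥ d_p − (b − a − 2) if |W(T)| = 2; (b) L_T(y_{j_0}) + L_T(y_{j_{2mn−1}}) = 0; (c) y_{j_t} and y_{j_{t+1}} are in different branches of T when |W(T)| = 1 and in opposite branches when |W(T)| = 2, for all 0 ≤ t ≤ 2mn − 2; and (d) min{d_T(y_{j_t}, y_{j_{t+1}}), d_T(y_{j_{t+1}}, y_{j_{t+2}})} ≤ (d_t + 1 − ε)/2 for all 0 ≤ t ≤ 2mn − 3. Then rn(P_{m,k} □ T) =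 (2mn − 1)(d_t + ε) − 4m·L(T). -/

import Mathlib

/-!
Common definitions: radio labelings, weight centers, levels, branches,
generalized Petersen graphs, stars.
-/

open Finset

namespace RadioPaper

variable {V : Type*}

/-- The diameter of a finite graph: the maximum distance between two vertices. -/
noncomputable def graphDiam [Fintype V] (G : SimpleGraph V) : ℕ :=
  Finset.univ.sup fun p : V × V => G.dist p.1 p.2

/-- A radio labeling of `G`: `|f u - f v| ≥ diam G + 1 - d(u,v)` for distinct `u, v`. -/
def IsRadioLabeling [Fintype V] (G : SimpleGraph V) (f : V → ℕ) : Prop :=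
  ∀ u v : V, u ≠ v → (graphDiam G : ℤ) + 1 - G.dist u v ≤ |(f u : ℤ) - (f v : ℤ)|

/-- The span of a labeling: the maximum of `|f u - f v|` over all pairs of vertices. -/
noncomputable def radioSpan [Fintype V] (f : V → ℕ) : ℕ :=
  Finset.univ.sup fun p : V × V => f p.1 - f p.2

/-- The radio number of `G`: the minimum span over all radio labelings. -/
noncomputable def radioNumber [Fintype V] (G : SimpleGraph V) : ℕ :=
  sInf {s : ℕ | ∃ f : V → ℕ, IsRadioLabeling G f ∧ radioSpan f = s}

/-- The weight of a graph at a vertex `u`: the sum of distances from `u` to all vertices. -/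
noncomputable def weight [Fintype V] (T : SimpleGraph V) (u : V) : ℕ :=
  ∑ v : V, T.dist u v

/-- The set of weight centers: vertices minimizing the weight. -/
def weightCenters [Fintype V] (T : SimpleGraph V) : Set V :=
  {c | ∀ u : V, weight T c ≤ weight T u}

/-- The level of a vertex: its distance to a nearest weight center. -/
noncomputable def level [Fintype V] (T : SimpleGraph V) (x : V) : ℕ :=
  sInf {d : ℕ | ∃ w ∈ weightCenters T, T.dist x w = d}

/-- The total level of `T`: sum of the levels of all vertices. -/
noncomputable def totalLevel [Fintype V] (T : SimpleGraph V) : ℕ :=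
  ∑ x : V, level T x

/-- `ε(T) = 1` if `T` has a unique weight center, and `0` otherwise (two centers). -/
noncomputable def eps [Fintype V] (T : SimpleGraph V) : ℕ :=
  if (weightCenters T).ncard = 1 then 1 else 0

/-- `z` is an ancestor of `x` in the tree rooted at its weight center(s):
`z` lies on the path from some weight center to `x`. -/
def IsAncestor [Fintype V] (T : SimpleGraph V) (z x : V) : Prop :=
  ∃ w ∈ weightCenters T, T.dist w z + T.dist z x = T.dist w x

/-- `φ_T(x,y)`: the maximum level of a common ancestor of `x` and `y`. -/
noncomputable def phi [Fintype V] (T : SimpleGraph V) (x y : V) : ℕ :=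
  sSup {l : ℕ | ∃ z : V, IsAncestor T z x ∧ IsAncestor T z y ∧ level T z = l}

/-- `x` and `y` are in opposite branches: `T` has two weight centers `w, w'` and
`x, y` lie in different components of `T - ww'`. -/
def OppositeBranches [Fintype V] (T : SimpleGraph V) (x y : V) : Prop :=
  ∃ w w' : V, w ≠ w' ∧ weightCenters T = {w, w'} ∧
    ¬ (T.deleteEdges {s(w, w')}).Reachable x y

open Classical in
/-- `δ_T(x,y) = 1` if `T` has two weight centers and `x, y` are in opposite branches,
and `0` otherwise. -/
noncomputable def delta [Fintype V] (T : SimpleGraph V) (x y : V) : ℕ :=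
  if (weightCenters T).ncard = 2 ∧ OppositeBranches T x y then 1 else 0

/-- `x` and `y` are in different branches: some weight center lies on the `x`–`y` path
(equivalently, the paths from the center to `x` and to `y` depart through different
neighbours, or one of `x, y` is a weight center). -/
def DifferentBranches [Fintype V] (T : SimpleGraph V) (x y : V) : Prop :=
  ∃ w ∈ weightCenters T, T.dist x w + T.dist w y = T.dist x y

/-- `x` and `y` are in the same branch: both belong to the branch of `T` induced by some
non-central neighbour `u` of a weight center `w` together with all of `u`'s descendants. -/
def SameBranch [Fintype V] (T : SimpleGraph V) (x y : V) : Prop :=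
  ∃ w ∈ weightCenters T, ∃ u : V, u ∉ weightCenters T ∧ T.Adj w u ∧
    T.dist w x = 1 + T.dist u x ∧ T.dist w y = 1 + T.dist u y

/-- The generalized Petersen graph `P_{m,k}`: outer vertices `(false, i)` (the `u_i`) and
inner vertices `(true, i)` (the `v_i`), with edges `u_i u_{i+1}`, `u_i v_i`, `v_i v_{i+k}`. -/
def genPetersen (m k : ℕ) : SimpleGraph (Bool × ZMod m) :=
  SimpleGraph.fromRel fun a b =>
    (a.1 = false ∧ b.1 = false ∧ b.2 = a.2 + 1) ∨
    (a.1 = false ∧ b.1 = true ∧ a.2 = b.2) ∨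
    (a.1 = true ∧ b.1 = true ∧ b.2 = a.2 + (k : ZMod m))

/-- The star `K_{1,n}`: vertex `0` is the centre, joined to the `n` leaves. -/
def starGraph (n : ℕ) : SimpleGraph (Fin (n + 1)) :=
  SimpleGraph.fromRel fun a _ => a = 0

section Diameter

variable [Fintype V]

lemma dist_le_graphDiam (G : SimpleGraph V) (u v : V) : G.dist u v ≤ graphDiam G :=
  Finset.le_sup (f := fun p : V × V => G.dist p.1 p.2) (mem_univ (u, v))

lemma exists_dist_eq_graphDiam [Nonempty V] (G : SimpleGraph V) :
    ∃ u v : V, G.dist u v = graphDiam G := by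
  obtain ⟨p, -, hp⟩ := Finset.exists_mem_eq_sup (univ : Finset (V × V)) univ_nonempty
    fun p : V × V => G.dist p.1 p.2
  exact ⟨p.1, p.2, hp.symm⟩

end Diameter

section BoxProd

variable {W : Type*} {G : SimpleGraph V} {H : SimpleGraph W}

lemma dist_boxProd (hG : G.Connected) (hH : H.Connected) (x y : V × W) :
    (G.boxProd H).dist x y = G.dist x.1 y.1 + H.dist x.2 y.2 := by
  have h := SimpleGraph.edist_boxProd (G := G) (H := H) x y
  rw [← (hG x.1 y.1).coe_dist_eq_edist, ← (hH x.2 y.2).coe_dist_eq_edist,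
    ← ((hG.boxProd hH) x y).coe_dist_eq_edist] at h
  exact_mod_cast h

lemma graphDiam_boxProd [Fintype V] [Fintype W] (hG : G.Connected) (hH : H.Connected) :
    graphDiam (G.boxProd H) = graphDiam G + graphDiam H := by
  have := hG.nonempty
  have := hH.nonempty
  apply le_antisymm
  · refine Finset.sup_le fun p _ => ?_
    rw [dist_boxProd hG hH]
    exact add_le_add (dist_le_graphDiam G _ _) (dist_le_graphDiam H _ _)
  · obtain ⟨a, b, hab⟩ := exists_dist_eq_graphDiam G
    obtain ⟨c, d, hcd⟩ := exists_dist_eq_graphDiam H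
    rw [← hab, ← hcd, ← dist_boxProd hG hH (a, c) (b, d)]
    exact dist_le_graphDiam _ _ _

end BoxProd

lemma genPetersen_connected (m k : ℕ) [NeZero m] : (genPetersen m k).Connected := by
  have outer (i : ℕ) : (genPetersen m k).Reachable (false, 0) (false, (i : ZMod m)) := by
    induction i with
    | zero => simp
    | succ i ih =>
      refine ih.trans ?_
      by_cases h : ((false, (i : ZMod m)) : Bool × ZMod m) = (false, ((i + 1 : ℕ) : ZMod m))
      · rw [h]
      · apply SimpleGraph.Adj.reachable
        rw [genPetersen, SimpleGraph.fromRel_adj]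
        exact ⟨h, Or.inl (Or.inl ⟨rfl, rfl, by push_cast; rfl⟩)⟩
  have from_zero (x : Bool × ZMod m) : (genPetersen m k).Reachable (false, 0) x := by
    obtain ⟨b, i⟩ := x
    have h := outer i.val
    rw [ZMod.natCast_zmod_val] at h
    cases b with
    | false => exact h
    | true =>
      refine h.trans (SimpleGraph.Adj.reachable ?_)
      rw [genPetersen, SimpleGraph.fromRel_adj]
      exact ⟨by simp, Or.inl (Or.inr (Or.inl ⟨rfl, rfl, rfl⟩))⟩
  have : Nonempty (Bool × ZMod m) := ⟨(false, 0)⟩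
  exact ⟨fun x y => (from_zero x).symm.trans (from_zero y)⟩

section Tree

variable {T : SimpleGraph V}

lemma eq_of_adj_of_dist_eq_add_one (hT : T.IsTree) {a b c x : V} (hab : T.Adj a b)
    (hcb : T.Adj c b) (ha : T.dist x b = T.dist x a + 1) (hc : T.dist x b = T.dist x c + 1) :
    a = c := by
  obtain ⟨p, hp⟩ := hT.connected.exists_walk_length_eq_dist x a
  obtain ⟨q, hq⟩ := hT.connected.exists_walk_length_eq_dist x c
  have hp' : (p.concat hab).IsPath :=
    SimpleGraph.Walk.isPath_of_length_eq_dist _ (by simp [hp, ha])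
  have hq' : (q.concat hcb).IsPath :=
    SimpleGraph.Walk.isPath_of_length_eq_dist _ (by simp [hq, hc])
  have h := congrArg Subtype.val ((hT.isAcyclic.subsingleton_path x b).elim ⟨_, hp'⟩ ⟨_, hq'⟩)
  simpa using congrArg SimpleGraph.Walk.penultimate h

lemma two_mul_dist_le (hT : T.IsTree) {a b c : V} (hab : T.Adj a b) (hcb : T.Adj c b)
    (hac : a ≠ c) (x : V) : 2 * T.dist b x ≤ T.dist a x + T.dist c x := by
  have h1 := hT.dist_eq_dist_add_one_of_adj x hab
  have h2 := hT.dist_eq_dist_add_one_of_adj x hcb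
  have h3 := fun h h' => hac (eq_of_adj_of_dist_eq_add_one hT hab hcb (x := x) h h')
  rw [T.dist_comm (u := b), T.dist_comm (u := a), T.dist_comm (u := c)]
  by_cases h : T.dist x b = T.dist x a + 1
  · have h4 : ¬T.dist x b = T.dist x c + 1 := h3 h
    omega
  · omega

lemma exists_adj_dist_eq_add_one (hT : T.Connected) {x y : V} (hxy : x ≠ y) :
    ∃ c, T.Adj x c ∧ T.dist x y = T.dist c y + 1 := by
  obtain ⟨p, hp⟩ := hT.exists_walk_length_eq_dist x y
  cases p with
  | nil => exact absurd rfl hxy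
  | cons h q =>
    rename_i c
    refine ⟨c, h, ?_⟩
    have h1 := SimpleGraph.dist_le q
    have h2 := hT.dist_triangle (u := x) (v := c) (w := y)
    rw [SimpleGraph.dist_eq_one_iff_adj.mpr h] at h2
    simp only [SimpleGraph.Walk.length_cons] at hp
    omega

variable [Fintype V]

lemma two_mul_weight_lt (hT : T.IsTree) {a b c : V} (hab : T.Adj a b) (hcb : T.Adj c b)
    (hac : a ≠ c) : 2 * weight T b < weight T a + weight T c := by
  unfold weight
  rw [Finset.mul_sum, ← Finset.sum_add_distrib]
  refine Finset.sum_lt_sum (fun x _ => two_mul_dist_le hT hab hcb hac x) ⟨b, mem_univ b, ?_⟩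
  have := SimpleGraph.dist_eq_one_iff_adj.mpr hab
  simp only [SimpleGraph.dist_self]
  omega

lemma weight_lt_of_dist_eq_add_one (hT : T.IsTree) {a b y : V} (hab : T.Adj a b)
    (hw : weight T a ≤ weight T b) (hd : T.dist a y = T.dist b y + 1) (hby : b ≠ y) :
    weight T b < weight T y := by
  induction hn : T.dist b y generalizing a b with
  | zero => exact absurd (hT.connected.dist_eq_zero_iff.mp hn) hby
  | succ n ih =>
    obtain ⟨c, hbc, hc⟩ := exists_adj_dist_eq_add_one hT.connected hby
    have hac : a ≠ c := by
      rintro rfl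
      omega
    have h := two_mul_weight_lt hT hab hbc.symm hac
    by_cases hcy : c = y
    · subst hcy
      omega
    · have := ih hbc (by omega) hc hcy (by omega)
      omega

lemma adj_of_mem_weightCenters (hT : T.IsTree) {w w' : V} (hw : w ∈ weightCenters T)
    (hw' : w' ∈ weightCenters T) (hne : w ≠ w') : T.Adj w w' := by
  obtain ⟨c, hc, hd⟩ := exists_adj_dist_eq_add_one hT.connected hne
  by_cases hcw : c = w'
  · exact hcw ▸ hc
  · have h1 := weight_lt_of_dist_eq_add_one hT hc (hw c) hd hcw
    have h2 := hw c
    have h3 := hw' w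
    omega

lemma weightCenters_nonempty (hT : T.IsTree) : (weightCenters T).Nonempty := by
  have := hT.connected.nonempty
  obtain ⟨c, -, hc⟩ := Finset.exists_min_image univ (weight T) univ_nonempty
  exact ⟨c, fun u => hc u (mem_univ u)⟩

lemma ncard_weightCenters (hT : T.IsTree) :
    (weightCenters T).ncard = 1 ∨ (weightCenters T).ncard = 2 := by
  obtain ⟨w, hw⟩ := weightCenters_nonempty hT
  by_cases h : ∃ w' ∈ weightCenters T, w ≠ w'
  · obtain ⟨w', hw', hne⟩ := h
    right
    have : weightCenters T = {w, w'} := by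
      ext x
      refine ⟨fun hx => ?_, ?_⟩
      · by_contra hx'
        simp only [Set.mem_insert_iff, Set.mem_singleton_iff, not_or] at hx'
        have h1 := adj_of_mem_weightCenters hT hx hw hx'.1
        have h2 := adj_of_mem_weightCenters hT hx hw' hx'.2
        have h3 := adj_of_mem_weightCenters hT hw hw' hne
        apply hT.dist_ne_of_adj x h3
        rw [SimpleGraph.dist_eq_one_iff_adj.mpr h1, SimpleGraph.dist_eq_one_iff_adj.mpr h2]
      · rintro (rfl | rfl) <;> assumption
    rw [this, Set.ncard_pair hne]
  · left
    push Not at h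
    rw [Set.ncard_eq_one]
    exact ⟨w, Set.eq_singleton_iff_unique_mem.mpr ⟨hw, fun x hx => (h x hx).symm⟩⟩

lemma level_le_dist {w : V} (hw : w ∈ weightCenters T) (x : V) : level T x ≤ T.dist x w :=
  Nat.sInf_le ⟨w, hw, rfl⟩

lemma exists_level_eq_dist (hT : T.IsTree) (x : V) :
    ∃ w ∈ weightCenters T, T.dist x w = level T x := by
  obtain ⟨w, hw⟩ := weightCenters_nonempty hT
  exact Nat.sInf_mem (s := {d : ℕ | ∃ w ∈ weightCenters T, T.dist x w = d}) ⟨_, w, hw, rfl⟩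

lemma level_le_level_add_dist (hT : T.IsTree) (x y : V) :
    level T x ≤ level T y + T.dist x y := by
  obtain ⟨w, hw, h⟩ := exists_level_eq_dist hT y
  have h1 := level_le_dist hw x
  have h2 := hT.connected.dist_triangle (u := x) (v := y) (w := w)
  omega

lemma dist_add_eps_le (hT : T.IsTree) (x y : V) :
    T.dist x y + eps T ≤ level T x + level T y + 1 := by
  obtain ⟨w, hw, h⟩ := exists_level_eq_dist hT x
  obtain ⟨w', hw', h'⟩ := exists_level_eq_dist hT y
  have h1 := hT.connected.dist_triangle (u := x) (v := w) (w := y)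
  have h2 := hT.connected.dist_triangle (u := w) (v := w') (w := y)
  rw [T.dist_comm (u := w') (v := y)] at h2
  have heps : eps T ≤ 1 := by
    unfold eps
    split_ifs <;> simp
  by_cases hww : w = w'
  · subst hww
    simp only [SimpleGraph.dist_self] at h2
    omega
  · have h3 := SimpleGraph.dist_eq_one_iff_adj.mpr (adj_of_mem_weightCenters hT hw hw' hww)
    have h4 : eps T = 0 := by
      rw [eps, if_neg]
      intro h5
      obtain ⟨c, hc⟩ := Set.ncard_eq_one.mp h5
      rw [hc, Set.mem_singleton_iff] at hw hw'
      exact hww (hw.trans hw'.symm)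
    omega

lemma level_add_level_le_of_differentBranches {x y : V} (h : DifferentBranches T x y) :
    level T x + level T y ≤ T.dist x y := by
  obtain ⟨w, hw, h⟩ := h
  have h1 := level_le_dist hw x
  have h2 := level_le_dist hw y
  rw [T.dist_comm (u := y)] at h2
  omega

lemma level_add_level_lt_of_oppositeBranches (hT : T.IsTree) {x y : V}
    (h : OppositeBranches T x y) : level T x + level T y + 1 ≤ T.dist x y := by
  obtain ⟨w, w', -, hW, h⟩ := h
  have hw : w ∈ weightCenters T := by simp [hW]
  have hw' : w' ∈ weightCenters T := by simp [hW]
  obtain ⟨p, hp⟩ := hT.connected.exists_walk_length_eq_dist x y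
  rw [SimpleGraph.reachable_deleteEdges_iff_exists_walk] at h
  push Not at h
  obtain ⟨c, d, hcd, q, r, hqr, hc, hd⟩ : ∃ c d, ∃ hcd : T.Adj c d, ∃ q : T.Walk x c,
      ∃ r : T.Walk d y, p.length = q.length + r.length + 1 ∧ c ∈ weightCenters T ∧
        d ∈ weightCenters T := by
    have key : ∀ {x y : V} (p : T.Walk x y), s(w, w') ∈ p.edges → ∃ c d, ∃ _ : T.Adj c d,
        ∃ q : T.Walk x c, ∃ r : T.Walk d y, p.length = q.length + r.length + 1 ∧
          c ∈ weightCenters T ∧ d ∈ weightCenters T := by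
      intro x y p hmem
      induction p with
      | nil => simp at hmem
      | cons hadj p ih =>
        rw [SimpleGraph.Walk.edges_cons, List.mem_cons] at hmem
        rcases hmem with hmem | hmem
        · refine ⟨_, _, hadj, SimpleGraph.Walk.nil, p, by simp, ?_⟩
          rw [Sym2.eq_iff] at hmem
          rcases hmem with ⟨rfl, rfl⟩ | ⟨rfl, rfl⟩
          · exact ⟨hw, hw'⟩
          · exact ⟨hw', hw⟩
        · obtain ⟨c, d, hcd, q, r, hl, hcd'⟩ := ih hmem
          refine ⟨c, d, hcd, SimpleGraph.Walk.cons hadj q, r, ?_, hcd'⟩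
          simp only [SimpleGraph.Walk.length_cons, hl]
          omega
    exact key p (h p)
  have h1 := level_le_dist hc x
  have h2 := level_le_dist hd y
  have h3 := SimpleGraph.dist_le q
  have h4 := SimpleGraph.dist_le r
  rw [T.dist_comm] at h4
  omega

lemma dist_add_eps_eq (hT : T.IsTree) {x y : V}
    (h1 : (weightCenters T).ncard = 1 → DifferentBranches T x y)
    (h2 : (weightCenters T).ncard = 2 → OppositeBranches T x y) :
    T.dist x y + eps T = level T x + level T y + 1 := by
  refine le_antisymm (dist_add_eps_le hT x y) ?_
  rcases ncard_weightCenters hT with h | h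
  · have := level_add_level_le_of_differentBranches (h1 h)
    simp only [eps, h, if_true]
    omega
  · have := level_add_level_lt_of_oppositeBranches hT (h2 h)
    omega

end Tree

/-- If any two labels differ by at least `A - g u - g v`, then ordering the elements of `s` by
label gives a telescoping lower bound for the difference of the extreme labels. -/
lemma exists_sub_ge_of_abs_sub_ge {f g : V → ℤ} {A : ℤ}
    (h : ∀ u v, u ≠ v → A - g u - g v ≤ |f u - f v|) (s : Finset V) (hs : s.Nonempty) :
    ∃ a ∈ s, ∃ b ∈ s, (∀ v ∈ s, f v ≤ f b) ∧
      ((#s : ℤ) - 1) * A - 2 * ∑ v ∈ s, g v + g a + g b ≤ f b - f a := by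
  classical
  induction s using Finset.induction_on_max_value f with
  | empty => simp at hs
  | insert x s hx hmax ih =>
    rcases s.eq_empty_or_nonempty with rfl | hs'
    · refine ⟨x, by simp, x, by simp, by simp, ?_⟩
      simp
      linarith
    · obtain ⟨a, ha, b, hb, hbmax, hab⟩ := ih hs'
      refine ⟨a, by simp [ha], x, by simp, ?_, ?_⟩
      · intro v hv
        rcases Finset.mem_insert.mp hv with rfl | hv
        · exact le_rfl
        · exact hmax v hv
      · have hxb := h x b (by rintro rfl; exact hx hb)
        rw [abs_of_nonneg (by linarith [hmax b hb])] at hxb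
        rw [Finset.card_insert_of_notMem hx, Finset.sum_insert hx]
        push_cast
        linarith

lemma le_radioSpan_boxProd {W : Type*} [Fintype V] [Fintype W] {G : SimpleGraph V}
    {T : SimpleGraph W} (hG : G.Connected) (hT : T.IsTree) {f : V × W → ℕ}
    (hf : IsRadioLabeling (G.boxProd T) f) :
    ((Fintype.card V * Fintype.card W : ℤ) - 1) * ((graphDiam T : ℤ) + eps T) -
      2 * Fintype.card V * totalLevel T ≤ radioSpan f := by
  have := hG.nonempty
  have := hT.connected.nonempty
  obtain ⟨a, -, b, -, -, hab⟩ := exists_sub_ge_of_abs_sub_ge (f := fun v => (f v : ℤ))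
    (g := fun v => (level T v.2 : ℤ)) (A := (graphDiam T : ℤ) + eps T) (by
      intro u v huv
      refine le_trans ?_ (hf u v huv)
      rw [graphDiam_boxProd hG hT.connected, dist_boxProd hG hT.connected]
      have h1 := dist_le_graphDiam G u.1 v.1
      have h2 := dist_add_eps_le hT u.2 v.2
      push_cast
      omega) univ univ_nonempty
  have hspan : f b - f a ≤ radioSpan f :=
    Finset.le_sup (f := fun p : (V × W) × (V × W) => f p.1 - f p.2) (mem_univ (b, a))
  have hsum : ∑ v : V × W, (level T v.2 : ℤ) = Fintype.card V * totalLevel T := by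
    rw [Fintype.sum_prod_type]
    simp [totalLevel]
  rw [hsum, Finset.card_univ, Fintype.card_prod] at hab
  push_cast at hab
  have h3 : (f b : ℤ) - f a ≤ radioSpan f := by omega
  linarith [Int.natCast_nonneg (level T a.2), Int.natCast_nonneg (level T b.2)]

section Labels

variable {L : ℕ → ℤ} {H : ℤ} {N : ℕ}

/-- Labels with consecutive differences `H + 1 - L t - L (t + 1)`. -/
def cumulativeLabel (L : ℕ → ℤ) (H : ℤ) (t : ℕ) : ℤ :=
  ∑ i ∈ range t, (H + 1 - L i - L (i + 1))

lemma cumulativeLabel_succ (L : ℕ → ℤ) (H : ℤ) (t : ℕ) :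
    cumulativeLabel L H (t + 1) = cumulativeLabel L H t + (H + 1 - L t - L (t + 1)) :=
  Finset.sum_range_succ _ _

lemma cumulativeLabel_eq (L : ℕ → ℤ) (H : ℤ) (t : ℕ) :
    cumulativeLabel L H t = t * (H + 1) - 2 * ∑ i ∈ range (t + 1), L i + L 0 + L t := by
  induction t with
  | zero => simp [cumulativeLabel]; ring
  | succ t ih =>
    rw [cumulativeLabel_succ, ih, Finset.sum_range_succ _ (t + 1)]
    push_cast
    ring

lemma sub_le_cumulativeLabel_sub (hstep : ∀ t, t + 1 < N → L t + L (t + 1) ≤ H) {a b : ℕ}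
    (hab : a ≤ b) (hb : b < N) :
    (b : ℤ) - a ≤ cumulativeLabel L H b - cumulativeLabel L H a := by
  induction b, hab using Nat.le_induction with
  | base => simp
  | succ b hab ih =>
    have h1 := ih (by omega)
    have h2 := hstep b hb
    rw [cumulativeLabel_succ]
    push_cast
    linarith

lemma two_mul_le_of_min_le (hstep : ∀ t, t + 1 < N → L t + L (t + 1) ≤ H)
    (hnonneg : ∀ t, 0 ≤ L t) (hN : 2 ≤ N) (h0 : L 0 = 0) (hlast : L (N - 1) = 0)
    (hmin : ∀ t, t + 2 < N → 2 * min (L t + L (t + 1)) (L (t + 1) + L (t + 2)) ≤ H)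
    {t : ℕ} (ht : t < N) : 2 * L t ≤ H := by
  have hH : 0 ≤ H := le_trans (add_nonneg (hnonneg 0) (hnonneg 1)) (hstep 0 (by omega))
  by_cases ht0 : t = 0
  · simp [ht0, h0, hH]
  by_cases htN : t = N - 1
  · simp [htN, hlast, hH]
  obtain ⟨s, rfl⟩ := Nat.exists_eq_succ_of_ne_zero ht0
  have h := hmin s (by omega)
  have h1 := hnonneg s
  have h2 := hnonneg (s + 2)
  simp only [Nat.succ_eq_add_one]
  omega

/-- Labels at least two positions apart are far apart, when one of any two consecutive level sums
is at most `H / 2`. -/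
lemma le_cumulativeLabel_sub (hstep : ∀ t, t + 1 < N → L t + L (t + 1) ≤ H)
    (hnonneg : ∀ t, 0 ≤ L t) (hN : 2 ≤ N) (h0 : L 0 = 0) (hlast : L (N - 1) = 0)
    (hmin : ∀ t, t + 2 < N → 2 * min (L t + L (t + 1)) (L (t + 1) + L (t + 2)) ≤ H)
    {a b : ℕ} (hab : a + 2 ≤ b) (hb : b < N) {δ : ℤ} (hδ0 : 0 ≤ δ)
    (hδ : |L a - L b| ≤ δ) :
    H - δ + (b - a) ≤ cumulativeLabel L H b - cumulativeLabel L H a := by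
  have hlevel : ∀ t, t < N → 2 * L t ≤ H :=
    fun t => two_mul_le_of_min_le hstep hnonneg hN h0 hlast hmin
  have hs1 := cumulativeLabel_succ L H a
  have hs2 := cumulativeLabel_succ L H (a + 1)
  have hs3 := cumulativeLabel_succ L H (a + 2)
  simp only [Nat.add_assoc, Nat.reduceAdd] at hs2 hs3
  have hm := hmin a (by omega)
  rcases hab.eq_or_lt with rfl | hab
  · rw [abs_le] at hδ
    push_cast
    omega
  · have hm' := hmin (a + 1) (by omega)
    simp only [Nat.add_assoc, Nat.reduceAdd] at hm'
    have hrest := sub_le_cumulativeLabel_sub hstep (a := a + 3) (by omega) hb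
    have ha := hlevel a (by omega)
    have ha1 := hlevel (a + 1) (by omega)
    have ha2 := hlevel (a + 2) (by omega)
    have ha3 := hlevel (a + 3) (by omega)
    push_cast at hrest
    omega

end Labels

/-- Theorem 3.3, sufficient condition (d): under the ordering conditions (a)–(c), if
`min{d_T(y_{j_t}, y_{j_{t+1}}), d_T(y_{j_{t+1}}, y_{j_{t+2}})} ≤ (d_t + 1 - ε)/2` for all
`t ≤ 2mn - 3`, then `rn(P_{m,k} □ T) = (2mn - 1)(d_t + ε) - 4m·L(T)`. -/
theorem radioNumber_eq_of_ordering_min_consecutive_dist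
    {Vt : Type*} [Fintype Vt] (m k n : ℕ) [NeZero m] (hm : 3 ≤ m) (hk : 1 ≤ k)
    (T : SimpleGraph Vt) (hT : T.IsTree) (hn : Fintype.card Vt = n)
    (o : ℕ → (Bool × ZMod m) × Vt)
    (ho : ∀ v : (Bool × ZMod m) × Vt, ∃! t : ℕ, t < 2 * m * n ∧ o t = v)
    (ha : ∀ t : ℕ, t + 1 < 2 * m * n →
      (genPetersen m k).dist (o t).1 (o (t + 1)).1 = graphDiam (genPetersen m k))
    (ha' : ∀ a b : ℕ, a + 2 ≤ b → b < 2 * m * n →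
      ((weightCenters T).ncard = 1 →
        (graphDiam (genPetersen m k) : ℤ) - ((b : ℤ) - a - 1) ≤
          ((genPetersen m k).dist (o a).1 (o b).1 : ℤ)) ∧
      ((weightCenters T).ncard = 2 →
        (graphDiam (genPetersen m k) : ℤ) - ((b : ℤ) - a - 2) ≤
          ((genPetersen m k).dist (o a).1 (o b).1 : ℤ)))
    (hb : level T (o 0).2 + level T (o (2 * m * n - 1)).2 = 0)
    (hc : ∀ t : ℕ, t + 1 < 2 * m * n →
      ((weightCenters T).ncard = 1 → DifferentBranches T (o t).2 (o (t + 1)).2) ∧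
      ((weightCenters T).ncard = 2 → OppositeBranches T (o t).2 (o (t + 1)).2))
    (hd : ∀ t : ℕ, t + 2 < 2 * m * n →
      2 * (min (T.dist (o t).2 (o (t + 1)).2) (T.dist (o (t + 1)).2 (o (t + 2)).2) : ℤ) ≤
        (graphDiam T : ℤ) + 1 - eps T) :
    (radioNumber ((genPetersen m k).boxProd T) : ℤ) =
      ((2 * m * n : ℤ) - 1) * ((graphDiam T : ℤ) + eps T) - 4 * m * totalLevel T := by
  classical
  subst hn
  set N := 2 * m * Fintype.card Vt with hN
  have hP := genPetersen_connected m k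
  have := hT.connected.nonempty
  have hN6 : 6 ≤ N := by
    have hcard : 1 ≤ Fintype.card Vt := Fintype.card_pos
    calc 6 = 2 * 3 * 1 := rfl
      _ ≤ N := by rw [hN]; gcongr
  have hcardP : Fintype.card (Bool × ZMod m) = 2 * m := by simp [ZMod.card]
  set L : ℕ → ℤ := fun t => (level T (o t).2 : ℤ) with hL
  set H : ℤ := (graphDiam T : ℤ) + eps T - 1 with hH
  have hdist (t : ℕ) (ht : t + 1 < N) :
      (T.dist (o t).2 (o (t + 1)).2 : ℤ) = L t + L (t + 1) + 1 - eps T := by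
    have := dist_add_eps_eq hT (hc t ht).1 (hc t ht).2
    simp only [hL]
    omega
  have hstep (t : ℕ) (ht : t + 1 < N) : L t + L (t + 1) ≤ H := by
    have h1 := hdist t ht
    have h2 := dist_le_graphDiam T (o t).2 (o (t + 1)).2
    omega
  have hnonneg (t : ℕ) : 0 ≤ L t := Int.natCast_nonneg _
  have h0 : L 0 = 0 := by simp only [hL]; omega
  have hlast : L (N - 1) = 0 := by simp only [hL]; omega
  have heps : (eps T : ℤ) = 0 ∨ (eps T : ℤ) = 1 := by
    unfold eps
    split_ifs <;> simp
  have hmin (t : ℕ) (ht : t + 2 < N) :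
      2 * min (L t + L (t + 1)) (L (t + 1) + L (t + 2)) ≤ H := by
    have h1 := hd t ht
    have h2 := hdist t (by omega)
    have h3 := hdist (t + 1) (by omega)
    rw [show t + 1 + 1 = t + 2 from rfl] at h3
    omega
  choose idx hidx huniq using ho
  have hidx_lt (v) : idx v < N := (hidx v).1
  have ho_idx (v) : o (idx v) = v := (hidx v).2
  have hidx_o (t : ℕ) (ht : t < N) : idx (o t) = t :=
    (huniq (o t) t ⟨ht, rfl⟩).symm
  set F := cumulativeLabel L H with hF
  have hF0 : F 0 = 0 := by simp [hF, cumulativeLabel]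
  have hFmono {a b : ℕ} (hab : a ≤ b) (hb : b < N) : (b : ℤ) - a ≤ F b - F a :=
    sub_le_cumulativeLabel_sub hstep hab hb
  have hFnonneg (t : ℕ) (ht : t < N) : 0 ≤ F t := by
    have := hFmono (Nat.zero_le t) ht
    omega
  have hFlast : F (N - 1) = ((2 * m * Fintype.card Vt : ℤ) - 1) *
      ((graphDiam T : ℤ) + eps T) - 4 * m * totalLevel T := by
    have hsum : ∑ i ∈ range N, L i = 2 * m * totalLevel T := by
      have : ∑ i ∈ range N, L i = ∑ v : (Bool × ZMod m) × Vt, (level T v.2 : ℤ) := by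
        refine Finset.sum_bij' (fun t _ => o t) (fun v _ => idx v) ?_ ?_ ?_ ?_ ?_
        · simp
        · simpa using hidx_lt
        · intro t ht
          exact hidx_o t (Finset.mem_range.mp ht)
        · simpa using ho_idx
        · simp [hL]
      rw [this, Fintype.sum_prod_type]
      simp [totalLevel, ZMod.card]
    rw [hF, cumulativeLabel_eq, h0, hlast, Nat.sub_add_cancel (by omega), hsum,
      Nat.cast_sub (by omega), hN, hH]
    push_cast
    ring
  have hlabel {a b : ℕ} (hab : a < b) (hb : b < N) :
      (graphDiam ((genPetersen m k).boxProd T) : ℤ) + 1 -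
        ((genPetersen m k).boxProd T).dist (o a) (o b) ≤ F b - F a := by
    rw [graphDiam_boxProd hP hT.connected, dist_boxProd hP hT.connected]
    push_cast
    rcases Nat.lt_or_ge b (a + 2) with hab' | hab'
    · obtain rfl : b = a + 1 := by omega
      have h1 := ha a hb
      have h2 := hdist a hb
      have h3 : F (a + 1) = F a + (H + 1 - L a - L (a + 1)) := cumulativeLabel_succ L H a
      omega
    · have hδ : |L a - L b| ≤ (T.dist (o a).2 (o b).2 : ℤ) := by
        have h1 := level_le_level_add_dist hT (o a).2 (o b).2
        have h2 := level_le_level_add_dist hT (o b).2 (o a).2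
        rw [T.dist_comm (u := (o b).2)] at h2
        rw [abs_le]
        simp only [hL]
        omega
      have h1 : H - T.dist (o a).2 (o b).2 + (b - a) ≤ F b - F a :=
        le_cumulativeLabel_sub hstep hnonneg (by omega) h0 hlast hmin hab' hb
          (Int.natCast_nonneg _) hδ
      have h2 := ha' a b hab' hb
      rcases ncard_weightCenters hT with h | h
      · have h3 := h2.1 h
        have h4 : eps T = 1 := by simp [eps, h]
        omega
      · have h3 := h2.2 h
        have h4 : eps T = 0 := by simp [eps, h]
        omega
  set f : (Bool × ZMod m) × Vt → ℕ := fun v => (F (idx v)).toNat with hf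
  have hfF (v) : (f v : ℤ) = F (idx v) := Int.toNat_of_nonneg (hFnonneg _ (hidx_lt v))
  have hradio : IsRadioLabeling ((genPetersen m k).boxProd T) f := by
    intro u v huv
    rw [hfF, hfF]
    rcases lt_trichotomy (idx u) (idx v) with h | h | h
    · have h1 := hlabel h (hidx_lt v)
      rw [ho_idx, ho_idx] at h1
      rw [abs_sub_comm]
      exact h1.trans (le_abs_self _)
    · exact absurd (by rw [← ho_idx u, h, ho_idx]) huv
    · have h1 := hlabel h (hidx_lt u)
      rw [ho_idx, ho_idx, SimpleGraph.dist_comm] at h1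
      exact h1.trans (le_abs_self _)
  have hspan : (radioSpan f : ℤ) ≤ F (N - 1) := by
    have : radioSpan f ≤ (F (N - 1)).toNat := by
      refine Finset.sup_le fun p _ => (Nat.sub_le _ _).trans ?_
      have h1 := hFmono (a := idx p.1) (b := N - 1) (by have := hidx_lt p.1; omega) (by omega)
      have h2 := hidx_lt p.1
      simp only [hf]
      omega
    have := hFnonneg (N - 1) (by omega)
    omega
  rw [← hFlast]
  apply le_antisymm
  · have hle : radioNumber ((genPetersen m k).boxProd T) ≤ radioSpan f :=
      Nat.sInf_le ⟨f, hradio, rfl⟩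
    exact le_trans (by exact_mod_cast hle) hspan
  · obtain ⟨f', hf', hs'⟩ : radioNumber ((genPetersen m k).boxProd T) ∈
        {s : ℕ | ∃ f, IsRadioLabeling ((genPetersen m k).boxProd T) f ∧ radioSpan f = s} :=
      Nat.sInf_mem ⟨_, f, hradio, rfl⟩
    have h1 := le_radioSpan_boxProd hP hT hf'
    rw [hcardP] at h1
    push_cast at h1
    rw [hFlast, ← hs']
    linarith

end RadioPaper
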